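/- (Primal convergence theorem.) Assume the transshipment problem is feasible. Under the Physarum dynamics, there exist a minimum-cost positive flow φ̂ and constants C > 0, a > 0 such that ‖φ(t) − φ̂‖_∞ ≤ C·e^{−at} for all t ≥ 0, and moreover the limit flow φ̂ has full support on the optimal set: supp φ̂ = Ĥ, where Ĥ is the set of arcs carried by some minimum-cost positive flow. -/

import Mathlib

open scoped BigOperators

section PhysarumSetup

variable {V E : Type*} [Fintype V] [Fintype E] [DecidableEq V] [DecidableEq E]

/-- Incidence (boundary) matrix of the digraph given by `tail`/`head`:
`+1` if `i` is the tail of `e`, `-1` if `i` is the head of `e`, `0` otherwise. -/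
def incMatrix (tail head : E → V) : Matrix V E ℝ :=
  Matrix.of fun i e => if tail e = i then (1 : ℝ) else if head e = i then -1 else 0

/-- The digraph has no loops. -/
def NoLoops (tail head : E → V) : Prop := ∀ e, tail e ≠ head e

/-- The digraph has no multiple arcs. -/
def NoMultiple (tail head : E → V) : Prop :=
  ∀ e f, tail e = tail f → head e = head f → e = f

/-- Adjacency in the underlying undirected graph. -/
def Adj (tail head : E → V) (i j : V) : Prop :=
  ∃ e, (tail e = i ∧ head e = j) ∨ (tail e = j ∧ head e = i)

/-- The underlying undirected graph is connected. -/
def IsConnectedGraph (tail head : E → V) : Prop :=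
  ∀ i j : V, Relation.ReflTransGen (Adj tail head) i j

/-- `φ` is a flow with source vector `b`: `Bφ = b`. -/
def IsFlow (tail head : E → V) (b : V → ℝ) (φ : E → ℝ) : Prop :=
  (incMatrix tail head).mulVec φ = b

/-- Net supply `b(S)` of a vertex set `S`. -/
def netSupply (b : V → ℝ) (S : Finset V) : ℝ := ∑ i ∈ S, b i

/-- `b*_max = max_{S ⊆ V} |b(S)|`. -/
noncomputable def bstarMax (b : V → ℝ) : ℝ :=
  sSup {x | ∃ S : Finset V, x = |netSupply b S|}

/-- `b*_min = min { |b(S)| : S ⊆ V, b(S) ≠ 0 }`. -/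
noncomputable def bstarMin (b : V → ℝ) : ℝ :=
  sInf {x | ∃ S : Finset V, netSupply b S ≠ 0 ∧ x = |netSupply b S|}

/-- The support of an arc vector. -/
def suppE (φ : E → ℝ) : Set E := {e | φ e ≠ 0}

/-- An arc set is a forest in the underlying undirected graph:
equivalently, it supports no nonzero circulation. -/
def ForestSupport (tail head : E → V) (s : Set E) : Prop :=
  ∀ γ : E → ℝ, (incMatrix tail head).mulVec γ = 0 → (∀ e, γ e ≠ 0 → e ∈ s) → γ = 0

/-- A basic feasible solution: a positive flow whose support is a forest
in the underlying undirected graph. -/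
def IsBFS (tail head : E → V) (b : V → ℝ) (f : E → ℝ) : Prop :=
  IsFlow tail head b f ∧ (∀ e, 0 ≤ f e) ∧ ForestSupport tail head (suppE f)

/-- A vector is circulation free if its support contains no directed cycle:
equivalently, it supports no nonzero nonnegative circulation. -/
def CirculationFree (tail head : E → V) (φ : E → ℝ) : Prop :=
  ∀ γ : E → ℝ, (incMatrix tail head).mulVec γ = 0 → (∀ e, 0 ≤ γ e) →
    (∀ e, γ e ≠ 0 → φ e ≠ 0) → γ = 0

/-- The weighted graph Laplacian `L(σ) = B · diag(σ/ℓ) · Bᵀ`. -/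
noncomputable def lap (tail head : E → V) (ℓ σ : E → ℝ) : Matrix V V ℝ :=
  incMatrix tail head * Matrix.diagonal (fun e => σ e / ℓ e) * (incMatrix tail head).transpose

/-- The field (slope) of a potential: `Ψ(p)_{ij} = (p_i - p_j)/ℓ_{ij}`. -/
noncomputable def field (tail head : E → V) (ℓ : E → ℝ) (p : V → ℝ) : E → ℝ :=
  fun e => (p (tail e) - p (head e)) / ℓ e

/-- The set of vertices incident to an arc set `H`. -/
def VSet (tail head : E → V) (H : Set E) : Set V :=
  {i | ∃ e ∈ H, tail e = i ∨ head e = i}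

/-- Undirected reachability using only arcs in `H`. -/
def UReach (tail head : E → V) (H : Set E) : V → V → Prop :=
  Relation.ReflTransGen
    (fun i j => ∃ e ∈ H, (tail e = i ∧ head e = j) ∨ (tail e = j ∧ head e = i))

/-- `WalkLen tail head ℓ H i j L`: there is a walk in the underlying undirected
graph of `H` from `i` to `j` of total `ℓ`-length `L`. -/
inductive WalkLen (tail head : E → V) (ℓ : E → ℝ) (H : Set E) : V → V → ℝ → Prop
  | refl (i : V) : WalkLen tail head ℓ H i i 0
  | step {j k : V} {L : ℝ} (i : V) (e : E) (he : e ∈ H)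
      (hik : (tail e = i ∧ head e = j) ∨ (tail e = j ∧ head e = i))
      (hw : WalkLen tail head ℓ H j k L) : WalkLen tail head ℓ H i k (ℓ e + L)

/-- The minimal `ℓ`-length of a connecting walk within `H`. -/
noncomputable def wdist (tail head : E → V) (ℓ : E → ℝ) (H : Set E) (i j : V) : ℝ :=
  sInf {L | WalkLen tail head ℓ H i j L}

/-- The `ℓ`-diameter of `H`: the maximum of `wdist` over pairs of vertices lying in
a common component of `H`. -/
noncomputable def wdiam (tail head : E → V) (ℓ : E → ℝ) (H : Set E) : ℝ :=
  sSup {x | ∃ i j : V, (∃ L, WalkLen tail head ℓ H i j L) ∧ x = wdist tail head ℓ H i j}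

/-- Maximum norm of `p` restricted to a vertex set `A`. -/
noncomputable def supNormOn (A : Set V) (p : V → ℝ) : ℝ := sSup {x | ∃ i ∈ A, x = |p i|}

/-- Maximum norm of an arc vector. -/
noncomputable def eSupNorm (x : E → ℝ) : ℝ := sSup {r | ∃ e : E, r = |x e|}

/-- `min { σ_e : σ_e > 0 }`. -/
noncomputable def minPos (σ : E → ℝ) : ℝ := sInf {x | ∃ e, 0 < σ e ∧ x = σ e}

/-- `min_e ℓ_e`. -/
noncomputable def minLen (ℓ : E → ℝ) : ℝ := sInf {x | ∃ e : E, x = ℓ e}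

/-- The cost `ℓᵀφ` of a flow. -/
def cost (ℓ φ : E → ℝ) : ℝ := ∑ e, ℓ e * φ e

/-- The transshipment problem is feasible: there is a positive flow. -/
def Feasible (tail head : E → V) (b : V → ℝ) : Prop :=
  ∃ φ : E → ℝ, IsFlow tail head b φ ∧ ∀ e, 0 ≤ φ e

/-- `φ` is a minimum-cost positive flow. -/
def IsOptimal (tail head : E → V) (ℓ : E → ℝ) (b : V → ℝ) (φ : E → ℝ) : Prop :=
  IsFlow tail head b φ ∧ (∀ e, 0 ≤ φ e) ∧
    ∀ ψ : E → ℝ, IsFlow tail head b ψ → (∀ e, 0 ≤ ψ e) → cost ℓ φ ≤ cost ℓ ψ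

/-- `Ĥ`: the set of arcs carried by some minimum-cost positive flow. -/
def optSupport (tail head : E → V) (ℓ : E → ℝ) (b : V → ℝ) : Set E :=
  {e | ∃ φ : E → ℝ, IsOptimal tail head ℓ b φ ∧ 0 < φ e}

/-- The current `φ(t) = σ(t)·Ψ(p(t))` of the Physarum solver. -/
noncomputable def current (tail head : E → V) (ℓ : E → ℝ) (σ : ℝ → E → ℝ)
    (p : ℝ → V → ℝ) (t : ℝ) : E → ℝ :=
  fun e => σ t e * field tail head ℓ (p t) e

/-- The Physarum dynamics: `σ(t) > 0` and continuously differentiable on `[0,∞)`,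
`L(σ(t)) p(t) = b`, and `σ' = φ - σ` where `φ(t) = σ(t)·Ψ(p(t))`. -/
structure PhysarumDynamics (tail head : E → V) (ℓ : E → ℝ) (b : V → ℝ)
    (σ : ℝ → E → ℝ) (p : ℝ → V → ℝ) : Prop where
  pos : ∀ t : ℝ, 0 ≤ t → ∀ e, 0 < σ t e
  kirchhoff : ∀ t : ℝ, 0 ≤ t → (lap tail head ℓ (σ t)).mulVec (p t) = b
  contp : ContinuousOn (fun t => p t) (Set.Ici (0 : ℝ))
  dyn : ∀ t ∈ Set.Ici (0 : ℝ), ∀ e : E,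
    HasDerivWithinAt (fun s => σ s e)
      (current tail head ℓ σ p t e - σ t e) (Set.Ici (0 : ℝ)) t

/-- A directed walk from `i` to `j` using the listed arcs in order. -/
inductive DiWalk (tail head : E → V) : V → V → List E → Prop
  | nil (i : V) : DiWalk tail head i i []
  | cons {j k : V} {es : List E} (i : V) (e : E) (h1 : tail e = i) (h2 : head e = j)
      (hw : DiWalk tail head j k es) : DiWalk tail head i k (e :: es)

/-- Discrete `∞`-harmonicity of `p` at node `i` with respect to the arc set `H`:
the maximal in-slope equals the maximal out-slope, and both are nonnegative. -/
noncomputable def InfHarmAt (tail head : E → V) (ℓ : E → ℝ) (H : Set E)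
    (p : V → ℝ) (i : V) : Prop :=
  sSup {r | ∃ e ∈ H, head e = i ∧ r = (p (tail e) - p i) / ℓ e}
    = sSup {r | ∃ e ∈ H, tail e = i ∧ r = (p i - p (head e)) / ℓ e}
  ∧ 0 ≤ sSup {r | ∃ e ∈ H, tail e = i ∧ r = (p i - p (head e)) / ℓ e}

end PhysarumSetup

open Matrix Set Filter Topology

section Finite

variable {E : Type*} [Fintype E]

lemma exists_pos_forall_le {f : E → ℝ} (hf : ∀ e, 0 < f e) : ∃ δ > 0, ∀ e, δ ≤ f e := by
  rcases isEmpty_or_nonempty E with h | h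
  · exact ⟨1, one_pos, fun e => h.elim e⟩
  · obtain ⟨e, he⟩ := Finite.exists_min f
    exact ⟨f e, hf e, he⟩

lemma exists_pos_forall_le_of {P : E → Prop} {f : E → ℝ} (hf : ∀ e, P e → 0 < f e) :
    ∃ δ > 0, ∀ e, P e → δ ≤ f e := by
  classical
  obtain ⟨δ, hδ, h⟩ := exists_pos_forall_le (f := fun e => if P e then f e else 1) (fun e => by
    by_cases he : P e
    · simpa [he] using hf e he
    · simp [he])
  exact ⟨δ, hδ, fun e he => by simpa [he] using h e⟩

lemma exists_forall_le_of {P : E → Prop} {ι : Type*} {S : Set ι} {F : E → ι → ℝ}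
    (h : ∀ e, P e → ∃ C, ∀ t ∈ S, F e t ≤ C) : ∃ C > 0, ∀ e, P e → ∀ t ∈ S, F e t ≤ C := by
  classical
  have h' : ∀ e, ∃ C, P e → ∀ t ∈ S, F e t ≤ C := fun e => by
    by_cases he : P e
    · obtain ⟨C, hC⟩ := h e he
      exact ⟨C, fun _ => hC⟩
    · exact ⟨0, fun h => (he h).elim⟩
  choose C hC using h'
  refine ⟨1 + ∑ e, |C e|, by positivity, fun e he t ht => (hC e he t ht).trans ?_⟩
  have := Finset.single_le_sum (f := fun e => |C e|) (fun _ _ => abs_nonneg _) (Finset.mem_univ e)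
  have := le_abs_self (C e)
  linarith

/-- Stiemke's lemma: a subspace meeting the nonnegative orthant only at the origin has a
strictly positive normal vector. -/
lemma Submodule.exists_pos_orthogonal (W : Submodule ℝ (E → ℝ))
    (hW : ∀ w ∈ W, (∀ e, 0 ≤ w e) → w = 0) :
    ∃ z : E → ℝ, (∀ e, 0 < z e) ∧ ∀ w ∈ W, ∑ e, z e * w e = 0 := by
  classical
  have hdisj : Disjoint (W : Set (E → ℝ)) (stdSimplex ℝ E) := by
    refine Set.disjoint_left.2 fun w hw hw' => ?_
    have := hw'.2
    simp [hW w hw hw'.1] at this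
  obtain ⟨f, u, v, hu, huv, hv⟩ := geometric_hahn_banach_closed_compact W.convex
    W.closed_of_finiteDimensional (convex_stdSimplex ℝ E) (isCompact_stdSimplex ℝ E) hdisj
  have hu0 : 0 < u := by simpa using hu 0 W.zero_mem
  refine ⟨fun e => f (Pi.single e 1), fun e => ?_, fun w hw => ?_⟩
  · exact hu0.trans (huv.trans (hv _ (single_mem_stdSimplex ℝ e)))
  · have hfw : f w = ∑ e, f (Pi.single e 1) * w e := by
      have := LinearMap.pi_apply_eq_sum_univ (f : (E → ℝ) →ₗ[ℝ] ℝ) w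
      simp only [ContinuousLinearMap.coe_coe, smul_eq_mul] at this
      rw [this]
      refine Finset.sum_congr rfl fun e _ => ?_
      rw [mul_comm]
      congr 2
      ext j
      simp [Pi.single_apply, eq_comm]
    rw [← hfw]
    by_contra hne
    have := hu _ (W.smul_mem (u / f w) hw)
    simp [div_mul_cancel₀ u hne] at this

end Finite

section StrictComplementarity

variable {V E : Type*} [Fintype E]

/-- A positive flow `φ` together with dual slacks `g` that are complementary to `φ` in the
strict sense. The dual solution itself enters only through the fact that `ℓ - g` is orthogonal
to all circulations. -/
structure StrictlyComplementary (B : Matrix V E ℝ) (ℓ : E → ℝ) (b : V → ℝ) (φ g : E → ℝ) :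
    Prop where
  flow : B *ᵥ φ = b
  nonneg : ∀ e, 0 ≤ φ e
  slack_nonneg : ∀ e, 0 ≤ g e
  slack_pos_iff : ∀ e, 0 < g e ↔ φ e = 0
  orthogonal : ∀ x, B *ᵥ x = 0 → ∑ e, (ℓ e - g e) * x e = 0

lemma StrictlyComplementary.slack_eq_zero {B : Matrix V E ℝ} {ℓ : E → ℝ} {b : V → ℝ}
    {φ g : E → ℝ} (h : StrictlyComplementary B ℓ b φ g) {e : E} (he : φ e ≠ 0) : g e = 0 := by
  by_contra hne
  exact he ((h.slack_pos_iff e).1 (lt_of_le_of_ne (h.slack_nonneg e) (Ne.symm hne)))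

variable [DecidableEq V] {tail head : E → V} {ℓ : E → ℝ} {b : V → ℝ}

lemma exists_isOptimal (hℓ : ∀ e, 0 < ℓ e) (hfeas : Feasible tail head b) :
    ∃ φ, IsOptimal tail head ℓ b φ := by
  obtain ⟨φ₀, hφ₀, hφ₀'⟩ := hfeas
  have hcont : Continuous (cost ℓ) := by unfold cost; fun_prop
  let K : Set (E → ℝ) := {φ | (IsFlow tail head b φ ∧ ∀ e, 0 ≤ φ e) ∧ cost ℓ φ ≤ cost ℓ φ₀}
  have hK : IsCompact K := by
    refine (isCompact_univ_pi (fun e => isCompact_Icc (a := (0 : ℝ)) (b := cost ℓ φ₀ / ℓ e))).of_isClosed_subset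
      ?_ ?_
    · refine (IsClosed.inter ?_ ?_).inter (isClosed_le hcont continuous_const)
      · exact isClosed_eq (f := fun φ => (incMatrix tail head) *ᵥ φ)
          (Continuous.matrix_mulVec continuous_const continuous_id) continuous_const
      · have : {φ : E → ℝ | ∀ e, 0 ≤ φ e} = ⋂ e, {φ | 0 ≤ φ e} := by ext; simp
        change IsClosed {φ : E → ℝ | ∀ e, 0 ≤ φ e}
        rw [this]
        exact isClosed_iInter fun e => isClosed_le continuous_const (continuous_apply e)
    · intro φ hφ e _
      refine ⟨hφ.1.2 e, ?_⟩
      rw [le_div_iff₀ (hℓ e), mul_comm]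
      refine le_trans ?_ hφ.2
      exact Finset.single_le_sum (f := fun e => ℓ e * φ e)
        (fun e _ => mul_nonneg (hℓ e).le (hφ.1.2 e)) (Finset.mem_univ e)
  obtain ⟨φ, hφ, hmin⟩ := hK.exists_isMinOn ⟨φ₀, ⟨hφ₀, hφ₀'⟩, le_rfl⟩ hcont.continuousOn
  refine ⟨φ, hφ.1.1, hφ.1.2, fun ψ hψ hψ' => ?_⟩
  rcases le_total (cost ℓ ψ) (cost ℓ φ₀) with h | h
  · exact hmin (show ψ ∈ K from ⟨⟨hψ, hψ'⟩, h⟩)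
  · exact hφ.2.trans h

lemma IsOptimal.midpoint {φ ψ : E → ℝ} (hφ : IsOptimal tail head ℓ b φ)
    (hψ : IsOptimal tail head ℓ b ψ) :
    IsOptimal tail head ℓ b ((1 / 2 : ℝ) • φ + (1 / 2 : ℝ) • ψ) := by
  refine ⟨?_, fun e => ?_, fun χ hχ hχ' => ?_⟩
  · have h1 := hφ.1
    have h2 := hψ.1
    unfold IsFlow at *
    rw [mulVec_add, mulVec_smul, mulVec_smul, h1, h2, ← add_smul]
    norm_num
  · have := hφ.2.1 e
    have := hψ.2.1 e
    simp only [Pi.add_apply, Pi.smul_apply, smul_eq_mul]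
    linarith
  · have h1 := hφ.2.2 χ hχ hχ'
    have h2 := hψ.2.2 χ hχ hχ'
    have : cost ℓ ((1 / 2 : ℝ) • φ + (1 / 2 : ℝ) • ψ)
        = (1 / 2) * cost ℓ φ + (1 / 2) * cost ℓ ψ := by
      simp only [cost, Finset.mul_sum, ← Finset.sum_add_distrib]
      refine Finset.sum_congr rfl fun e _ => ?_
      simp only [Pi.add_apply, Pi.smul_apply, smul_eq_mul]
      ring
    linarith

lemma exists_isOptimal_full_support (hℓ : ∀ e, 0 < ℓ e) (hfeas : Feasible tail head b) :
    ∃ φ, IsOptimal tail head ℓ b φ ∧ ∀ e ∈ optSupport tail head ℓ b, 0 < φ e := by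
  classical
  suffices h : ∀ s : Finset E, ∃ φ, IsOptimal tail head ℓ b φ ∧
      ∀ e ∈ s, e ∈ optSupport tail head ℓ b → 0 < φ e by
    obtain ⟨φ, hφ, h'⟩ := h Finset.univ
    exact ⟨φ, hφ, fun e he => h' e (Finset.mem_univ e) he⟩
  intro s
  induction s using Finset.induction_on with
  | empty =>
    obtain ⟨φ, hφ⟩ := exists_isOptimal hℓ hfeas
    exact ⟨φ, hφ, by simp⟩
  | insert a s _ ih =>
    obtain ⟨φ, hφ, h⟩ := ih
    by_cases ha : a ∈ optSupport tail head ℓ b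
    · obtain ⟨ψ, hψ, hψa⟩ := ha
      refine ⟨_, hφ.midpoint hψ, fun e he heo => ?_⟩
      have h1 := hφ.2.1 e
      have h2 := hψ.2.1 e
      simp only [Pi.add_apply, Pi.smul_apply, smul_eq_mul]
      rcases Finset.mem_insert.1 he with rfl | hes
      · linarith
      · linarith [h e hes heo]
    · refine ⟨φ, hφ, fun e he heo => ?_⟩
      rcases Finset.mem_insert.1 he with rfl | hes
      · exact (ha heo).elim
      · exact h e hes heo

lemma IsOptimal.exists_strictlyComplementary {φ : E → ℝ} (hφ : IsOptimal tail head ℓ b φ)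
    (hsupp : ∀ e ∈ optSupport tail head ℓ b, 0 < φ e) :
    ∃ g, StrictlyComplementary (incMatrix tail head) ℓ b φ g := by
  classical
  set B := incMatrix tail head with hB
  let T : (E → ℝ) →ₗ[ℝ] (Option E → ℝ) := LinearMap.pi fun o => o.elim
    (-∑ e, ℓ e • LinearMap.proj e) (fun e => if φ e = 0 then LinearMap.proj e else 0)
  have hTn : ∀ x, T x none = -∑ e, ℓ e * x e := fun x => by simp [T]
  have hTs : ∀ x e, T x (some e) = if φ e = 0 then x e else 0 := fun x e => by
    by_cases h : φ e = 0 <;> simp [T, h]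
  have hW : ∀ w ∈ (LinearMap.ker B.mulVecLin).map T, (∀ o, 0 ≤ w o) → w = 0 := by
    rintro _ ⟨x, hx, rfl⟩ hpos
    have hx0 : B *ᵥ x = 0 := by simpa using hx
    have hc : ∑ e, ℓ e * x e ≤ 0 := by
      have := hpos none
      rw [hTn] at this
      linarith
    have hoff : ∀ e, φ e = 0 → 0 ≤ x e := fun e he => by
      simpa [hTs, he] using hpos (some e)
    obtain ⟨δ, hδ, hδφ⟩ := exists_pos_forall_le_of (P := fun e => φ e ≠ 0) (f := φ)
      (fun e he => lt_of_le_of_ne (hφ.2.1 e) (Ne.symm he))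
    obtain ⟨ε, hε, hεx⟩ : ∃ ε > 0, ∀ e, ε * |x e| ≤ δ := by
      refine ⟨δ / (1 + ∑ e, |x e|), by positivity, fun e => ?_⟩
      rw [div_mul_eq_mul_div, div_le_iff₀ (by positivity)]
      refine mul_le_mul_of_nonneg_left ?_ hδ.le
      have := Finset.single_le_sum (f := fun e => |x e|) (fun _ _ => abs_nonneg _)
        (Finset.mem_univ e)
      linarith
    have hflow : IsFlow tail head b (φ + ε • x) := by
      have := hφ.1
      unfold IsFlow at *
      rw [mulVec_add, mulVec_smul, hx0, this]
      simp
    have hnn : ∀ e, 0 ≤ (φ + ε • x) e := fun e => by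
      simp only [Pi.add_apply, Pi.smul_apply, smul_eq_mul]
      by_cases he : φ e = 0
      · rw [he, zero_add]
        exact mul_nonneg hε.le (hoff e he)
      · nlinarith [hδφ e he, hεx e, neg_abs_le (x e)]
    have hcost : cost ℓ (φ + ε • x) = cost ℓ φ + ε * ∑ e, ℓ e * x e := by
      simp only [cost, Finset.mul_sum, ← Finset.sum_add_distrib]
      refine Finset.sum_congr rfl fun e _ => ?_
      simp only [Pi.add_apply, Pi.smul_apply, smul_eq_mul]
      ring
    have hc' : 0 ≤ ∑ e, ℓ e * x e := by
      have := hφ.2.2 _ hflow hnn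
      rw [hcost] at this
      by_contra! h
      nlinarith
    have hc0 : ∑ e, ℓ e * x e = 0 := le_antisymm hc hc'
    have hopt : IsOptimal tail head ℓ b (φ + ε • x) :=
      ⟨hflow, hnn, fun ψ hψ hψ' => by
        rw [hcost, hc0, mul_zero, add_zero]
        exact hφ.2.2 ψ hψ hψ'⟩
    funext o
    cases o with
    | none => simp [hTn, hc0]
    | some e =>
      rw [hTs]
      by_cases he : φ e = 0
      · simp only [he, if_true, Pi.zero_apply]
        by_contra hne
        have hpos : 0 < x e := lt_of_le_of_ne (hoff e he) (Ne.symm hne)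
        have := hsupp e ⟨_, hopt, by simpa [he] using mul_pos hε hpos⟩
        exact this.ne' he
      · simp [he]
  obtain ⟨z, hz, hzW⟩ := Submodule.exists_pos_orthogonal _ hW
  refine ⟨fun e => if φ e = 0 then z (some e) / z none else 0, hφ.1, hφ.2.1, fun e => ?_,
    fun e => ?_, fun x hx => ?_⟩
  · have := hz none
    have := hz (some e)
    positivity
  · have := div_pos (hz (some e)) (hz none)
    by_cases he : φ e = 0 <;> simp [he, this]
  · have hn := hz none
    have := hzW (T x) ⟨x, by simpa using hx, rfl⟩
    rw [Fintype.sum_option, hTn] at this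
    have h2 : ∑ e, (ℓ e - if φ e = 0 then z (some e) / z none else 0) * x e
        = ∑ e, ℓ e * x e - (∑ e, z (some e) * T x (some e)) / z none := by
      rw [Finset.sum_div, ← Finset.sum_sub_distrib]
      refine Finset.sum_congr rfl fun e _ => ?_
      rw [hTs]
      by_cases he : φ e = 0
      · simp only [he, if_true]; ring
      · simp [he]
    rw [h2, sub_eq_zero, eq_div_iff hn.ne']
    linarith

lemma StrictlyComplementary.isOptimal {φ g ψ : E → ℝ}
    (h : StrictlyComplementary (incMatrix tail head) ℓ b φ g) (hψ : IsFlow tail head b ψ)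
    (hψ₀ : ∀ e, 0 ≤ ψ e) (hψφ : ∀ e, φ e = 0 → ψ e = 0) : IsOptimal tail head ℓ b ψ := by
  refine ⟨hψ, hψ₀, fun χ hχ hχ₀ => ?_⟩
  have horth := h.orthogonal (χ - ψ) (by
    unfold IsFlow at *
    rw [mulVec_sub, hχ, hψ, sub_self])
  have hsum : cost ℓ χ - cost ℓ ψ = ∑ e, g e * χ e := by
    have : ∑ e, g e * χ e = ∑ e, (ℓ e * χ e - ℓ e * ψ e)
        - ∑ e, (ℓ e - g e) * (χ - ψ) e := by
      rw [← Finset.sum_sub_distrib]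
      refine Finset.sum_congr rfl fun e _ => ?_
      have hgψ : g e * ψ e = 0 := by
        by_cases he : φ e = 0
        · rw [hψφ e he, mul_zero]
        · rw [h.slack_eq_zero he, zero_mul]
      rw [Pi.sub_apply]
      linear_combination hgψ
    rw [this, horth, sub_zero, Finset.sum_sub_distrib]
    rfl
  have : 0 ≤ ∑ e, g e * χ e :=
    Finset.sum_nonneg fun e _ => mul_nonneg (h.slack_nonneg e) (hχ₀ e)
  linarith

end StrictComplementarity

section Dynamics

variable {V E : Type*} [Fintype E]

lemma eq_of_hasDerivWithinAt_zero {f : ℝ → ℝ}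
    (hf : ∀ t ∈ Ici (0 : ℝ), HasDerivWithinAt f 0 (Ici 0) t) {t : ℝ} (ht : 0 ≤ t) :
    f t = f 0 :=
  constant_of_has_deriv_right_zero
    (fun x hx => ((hf x hx.1).mono Icc_subset_Ici_self).continuousWithinAt)
    (fun x hx => (hf x hx.1).mono (Ici_subset_Ici.2 hx.1)) t ⟨ht, le_rfl⟩

lemma exists_linear_correction (B : Matrix V E ℝ) (P : E → Prop) :
    ∃ c, 0 ≤ c ∧ ∀ z w : E → ℝ, (∀ e, ¬ P e → w e = 0) → B *ᵥ (w + z) = 0 →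
      ∃ y : E → ℝ, (∀ e, ¬ P e → y e = 0) ∧ B *ᵥ (y + z) = 0 ∧
        ∀ e, |y e| ≤ c * ∑ f, |z f| := by
  classical
  let D : (E → ℝ) →ₗ[ℝ] (E → ℝ) := LinearMap.pi fun e => if P e then LinearMap.proj e else 0
  have hD : ∀ x e, D x e = if P e then x e else 0 := fun x e => by
    by_cases h : P e <;> simp [D, h]
  let A := B.mulVecLin ∘ₗ D
  obtain ⟨r, hr⟩ := A.rangeRestrict.exists_rightInverse_of_surjective A.range_rangeRestrict
  obtain ⟨G, hG⟩ := r.exists_extend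
  have hAG : ∀ x, A (G (A x)) = A x := fun x => by
    have h1 := LinearMap.congr_fun hG (A.rangeRestrict x)
    have h2 := LinearMap.congr_fun hr (A.rangeRestrict x)
    simp only [LinearMap.comp_apply, Submodule.subtype_apply, LinearMap.id_apply] at h1 h2
    rw [← h1] at h2
    exact congrArg Subtype.val h2
  let L := (-(D ∘ₗ G ∘ₗ B.mulVecLin)).toContinuousLinearMap
  have hL : ∀ z, L z = -D (G (B *ᵥ z)) := fun z => rfl
  refine ⟨‖L‖, norm_nonneg _, fun z w hw hwz => ⟨L z, fun e he => ?_, ?_, fun e => ?_⟩⟩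
  · rw [hL, Pi.neg_apply, hD, if_neg he, neg_zero]
  · have hDw : D w = w := by
      ext e
      rw [hD]
      split_ifs with h
      · rfl
      · exact (hw e h).symm
    have hz : B *ᵥ z = A (-w) := by
      have : A (-w) = -(B *ᵥ w) := by
        rw [map_neg]
        change -(B *ᵥ (D w)) = _
        rw [hDw]
      rw [this, eq_neg_iff_add_eq_zero, add_comm, ← mulVec_add]
      exact hwz
    have : B *ᵥ L z = -A (G (B *ᵥ z)) := by
      rw [hL, mulVec_neg]
      rfl
    rw [mulVec_add, this, hz, hAG, neg_add_cancel]
  · have h1 : ‖L z e‖ ≤ ‖L z‖ := norm_le_pi_norm _ e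
    have h2 : ‖z‖ ≤ ∑ f, |z f| :=
      (pi_norm_le_iff_of_nonneg (Finset.sum_nonneg fun _ _ => abs_nonneg _)).2 fun f =>
        Finset.single_le_sum (f := fun f => |z f|) (fun _ _ => abs_nonneg _) (Finset.mem_univ f)
    exact h1.trans ((L.le_opNorm z).trans (mul_le_mul_of_nonneg_left h2 (norm_nonneg _)))

/-- The Physarum dynamics with the potential eliminated: `Ψ t` is any slope vector which is
`ℓ`-orthogonal to the circulations of `B` and for which `σ t * Ψ t` is a flow. -/
structure SlopeDynamics (B : Matrix V E ℝ) (ℓ : E → ℝ) (b : V → ℝ) (σ Ψ : ℝ → E → ℝ) :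
    Prop where
  pos : ∀ t, 0 ≤ t → ∀ e, 0 < σ t e
  flow : ∀ t, 0 ≤ t → B *ᵥ (fun e => σ t e * Ψ t e) = b
  orthogonal : ∀ t, 0 ≤ t → ∀ x, B *ᵥ x = 0 → ∑ e, ℓ e * Ψ t e * x e = 0
  hasDeriv : ∀ t, 0 ≤ t → ∀ e,
    HasDerivWithinAt (fun s => σ s e) (σ t e * Ψ t e - σ t e) (Ici 0) t

namespace SlopeDynamics

variable {B : Matrix V E ℝ} {ℓ : E → ℝ} {b : V → ℝ} {σ Ψ : ℝ → E → ℝ}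

lemma mulVec_eq_zero (hd : SlopeDynamics B ℓ b σ Ψ) {φ : E → ℝ} (hφ : B *ᵥ φ = b) {t : ℝ}
    (ht : 0 ≤ t) :
    B *ᵥ (fun e => σ t e - φ e - Real.exp (-t) * (σ 0 e - φ e)) = 0 := by
  funext i
  have hconst := eq_of_hasDerivWithinAt_zero
    (f := fun s => Real.exp s * ∑ e, B i e * (σ s e - φ e)) (fun s hs => by
      have h1 : HasDerivWithinAt (fun s => ∑ e, B i e * (σ s e - φ e))
          (∑ e, B i e * (σ s e * Ψ s e - σ s e)) (Ici 0) s :=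
        HasDerivWithinAt.fun_sum fun e _ => ((hd.hasDeriv s hs e).sub_const _).const_mul _
      have h2 := (Real.hasDerivAt_exp s).hasDerivWithinAt.mul h1 (s := Ici 0)
      refine h2.congr_deriv ?_
      have h3 := congrFun (hd.flow s hs) i
      have h4 := congrFun hφ i
      simp only [mulVec, dotProduct] at h3 h4
      rw [← mul_add, ← Finset.sum_add_distrib]
      have : ∑ e, (B i e * (σ s e - φ e) + B i e * (σ s e * Ψ s e - σ s e))
          = ∑ e, B i e * (σ s e * Ψ s e) - ∑ e, B i e * φ e := by
        rw [← Finset.sum_sub_distrib]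
        exact Finset.sum_congr rfl fun e _ => by ring
      rw [this, h3, h4, sub_self, mul_zero]) ht
  simp only [Real.exp_zero, one_mul] at hconst
  simp only [mulVec, dotProduct, Pi.zero_apply]
  have : ∑ e, B i e * (σ t e - φ e - Real.exp (-t) * (σ 0 e - φ e))
      = ∑ e, B i e * (σ t e - φ e) - Real.exp (-t) * ∑ e, B i e * (σ 0 e - φ e) := by
    rw [Finset.mul_sum, ← Finset.sum_sub_distrib]
    exact Finset.sum_congr rfl fun e _ => by ring
  rw [this, ← hconst, ← mul_assoc, ← Real.exp_add]
  simp

lemma sum_log_mul_eq_zero (hd : SlopeDynamics B ℓ b σ Ψ) {g : E → ℝ}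
    (hg : ∀ x, B *ᵥ x = 0 → ∑ e, (ℓ e - g e) * x e = 0) {x : E → ℝ} (hx : B *ᵥ x = 0)
    {t : ℝ} (ht : 0 ≤ t) : ∑ e, (ℓ e * Real.log (σ t e / σ 0 e) + t * g e) * x e = 0 := by
  have hconst := eq_of_hasDerivWithinAt_zero
    (f := fun s => ∑ e, (ℓ e * (Real.log (σ s e) - Real.log (σ 0 e)) + s * g e) * x e)
    (fun s hs => by
      have h1 : HasDerivWithinAt
          (fun s => ∑ e, (ℓ e * (Real.log (σ s e) - Real.log (σ 0 e)) + s * g e) * x e)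
          (∑ e, (ℓ e * ((σ s e * Ψ s e - σ s e) / σ s e) + 1 * g e) * x e) (Ici 0) s :=
        HasDerivWithinAt.fun_sum fun e _ =>
          (((((hd.hasDeriv s hs e).log (hd.pos s hs e).ne').sub_const _).const_mul _).add
            ((hasDerivWithinAt_id _ _).mul_const _)).mul_const _
      refine h1.congr_deriv ?_
      have : ∑ e, (ℓ e * ((σ s e * Ψ s e - σ s e) / σ s e) + 1 * g e) * x e
          = ∑ e, ℓ e * Ψ s e * x e - ∑ e, (ℓ e - g e) * x e := by
        rw [← Finset.sum_sub_distrib]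
        refine Finset.sum_congr rfl fun e _ => ?_
        have := (hd.pos s hs e).ne'
        field_simp
        ring
      rw [this, hd.orthogonal s hs x hx, hg x hx, sub_zero]) ht
  simp only [sub_self, mul_zero, zero_mul, add_zero, Finset.sum_const_zero] at hconst
  refine (Finset.sum_congr rfl fun e _ => ?_).trans hconst
  rw [Real.log_div (hd.pos t ht e).ne' (hd.pos 0 le_rfl e).ne']

end SlopeDynamics

lemma Real.mul_exp_neg_le_one {t : ℝ} : t * Real.exp (-t) ≤ 1 := by
  rw [Real.exp_neg, ← div_eq_mul_inv, div_le_one (Real.exp_pos t)]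
  linarith [Real.add_one_le_exp t]

/-- `x * log (x / y) ≥ x - y`. -/
lemma Real.sub_le_mul_log_div {x y : ℝ} (hx : 0 < x) (hy : 0 < y) :
    x - y ≤ x * Real.log (x / y) := by
  have h := Real.one_sub_inv_le_log_of_pos (div_pos hx hy)
  have := mul_le_mul_of_nonneg_left h hx.le
  rwa [inv_div, mul_sub, mul_one, mul_div_cancel₀ _ hx.ne'] at this

lemma Real.mul_log_div_ge {x y k : ℝ} (hx : 0 < x) (hy : 0 < y) :
    -k * x - Real.exp (-k) * y ≤ x * Real.log (x / y) := by
  have h := Real.sub_le_mul_log_div hx (mul_pos (Real.exp_pos (-k)) hy)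
  have h2 : Real.log (x / (Real.exp (-k) * y)) = Real.log (x / y) + k := by
    rw [Real.log_div hx.ne' (by positivity), Real.log_mul (Real.exp_pos _).ne' hy.ne',
      Real.log_exp, Real.log_div hx.ne' hy.ne']
    ring
  rw [h2, mul_add] at h
  linarith

lemma Real.mul_log_div_le {x y v M : ℝ} (hx : 0 < x) (hy : 0 < y) (hv : 0 ≤ v) (hvM : v ≤ M)
    (hM : 0 < M) : v * Real.log (x / y) ≤ x / 2 + M * |Real.log (2 * M / y)| := by
  have h1 := Real.log_le_sub_one_of_pos (x := x / (2 * M)) (by positivity)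
  have h2 : Real.log (x / y) = Real.log (x / (2 * M)) + Real.log (2 * M / y) := by
    rw [← Real.log_mul (by positivity) (by positivity)]
    congr 1
    field_simp
  have h3 : v * Real.log (x / (2 * M)) ≤ x / 2 := by
    calc v * Real.log (x / (2 * M)) ≤ v * (x / (2 * M)) :=
          mul_le_mul_of_nonneg_left (by linarith) hv
      _ ≤ M * (x / (2 * M)) := mul_le_mul_of_nonneg_right hvM (by positivity)
      _ = x / 2 := by field_simp
  have h4 : v * Real.log (2 * M / y) ≤ M * |Real.log (2 * M / y)| :=
    (mul_le_mul_of_nonneg_left (le_abs_self _) hv).trans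
      (mul_le_mul_of_nonneg_right hvM (abs_nonneg _))
  rw [h2, mul_add]
  linarith

namespace SlopeDynamics

variable {B : Matrix V E ℝ} {ℓ : E → ℝ} {b : V → ℝ} {σ Ψ : ℝ → E → ℝ} {φ g : E → ℝ}

/-- The conductivities stay bounded, and on the support of `φ` they stay bounded away from
zero. -/
lemma exists_bounds (hd : SlopeDynamics B ℓ b σ Ψ) (hℓ : ∀ e, 0 < ℓ e)
    (hsc : StrictlyComplementary B ℓ b φ g) :
    (∃ S > 0, ∀ t, 0 ≤ t → ∀ e, σ t e ≤ S) ∧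
      ∃ K > 0, ∀ e, φ e ≠ 0 → ∀ t, 0 ≤ t → -K ≤ Real.log (σ t e / σ 0 e) := by
  have hσ0 : ∀ e, 0 < σ 0 e := hd.pos 0 le_rfl
  let v : ℝ → E → ℝ := fun t e => φ e + Real.exp (-t) * (σ 0 e - φ e)
  have hE : ∀ t : ℝ, 0 ≤ t → Real.exp (-t) ≤ 1 := fun t ht => Real.exp_le_one_iff.2 (by linarith)
  have hv0 : ∀ t, 0 ≤ t → ∀ e, 0 ≤ v t e := fun t ht e => by
    have := hE t ht
    have := Real.exp_pos (-t)
    have := hsc.nonneg e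
    have := hσ0 e
    simp only [v]
    nlinarith
  have hvM : ∀ t, 0 ≤ t → ∀ e, v t e ≤ φ e + σ 0 e := fun t ht e => by
    have := hE t ht
    have := Real.exp_pos (-t)
    have := hsc.nonneg e
    have := hσ0 e
    simp only [v]
    nlinarith
  let C : E → ℝ := fun e => ℓ e * (σ 0 e + (φ e + σ 0 e) *
    |Real.log (2 * (φ e + σ 0 e) / σ 0 e)|) + g e * σ 0 e
  have hC : ∀ e, 0 ≤ C e := fun e => by
    have := hsc.nonneg e
    have := hσ0 e
    have := hsc.slack_nonneg e
    have := hℓ e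
    positivity
  have hg : ∀ t, 0 ≤ t → ∀ e, -(g e * σ 0 e) ≤ t * g e * (σ t e - v t e) := fun t ht e => by
    have hgφ : g e * φ e = 0 := by
      by_cases he : φ e = 0
      · rw [he, mul_zero]
      · rw [hsc.slack_eq_zero he, zero_mul]
    have h1 : t * g e * (σ t e - v t e)
        = t * (g e * σ t e) - (t * Real.exp (-t)) * (g e * σ 0 e) := by
      simp only [v]
      linear_combination (-t + t * Real.exp (-t)) * hgφ
    have h2 := mul_nonneg ht (mul_nonneg (hsc.slack_nonneg e) (hd.pos t ht e).le)
    have h3 := mul_le_mul_of_nonneg_right (Real.mul_exp_neg_le_one (t := t))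
      (mul_nonneg (hsc.slack_nonneg e) (hσ0 e).le)
    linarith
  have hlow : ∀ t, 0 ≤ t → ∀ e, ℓ e * (σ t e / 2) - C e ≤
      (ℓ e * Real.log (σ t e / σ 0 e) + t * g e) * (σ t e - v t e) := fun t ht e => by
    have h1 := Real.sub_le_mul_log_div (hd.pos t ht e) (hσ0 e)
    have h2 := Real.mul_log_div_le (hd.pos t ht e) (hσ0 e) (hv0 t ht e) (hvM t ht e)
      (add_pos_of_nonneg_of_pos (hsc.nonneg e) (hσ0 e))
    have h3 := mul_le_mul_of_nonneg_left (sub_le_sub h1 h2) (hℓ e).le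
    have h4 := hg t ht e
    simp only [C]
    nlinarith
  have hup : ∀ t, 0 ≤ t → ∀ e,
      (ℓ e * Real.log (σ t e / σ 0 e) + t * g e) * (σ t e - v t e) ≤ ∑ f, C f := fun t ht e => by
    have hsum := hd.sum_log_mul_eq_zero hsc.orthogonal (hd.mulVec_eq_zero hsc.flow ht) ht
    have hle := Finset.single_le_sum (f := fun f =>
        (ℓ f * Real.log (σ t f / σ 0 f) + t * g f) * (σ t f - v t f) + C f) (fun f _ => by
          have := hlow t ht f
          have := mul_pos (hℓ f) (half_pos (hd.pos t ht f))
          linarith) (Finset.mem_univ e)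
    rw [Finset.sum_add_distrib] at hle
    have heq : ∑ f, (ℓ f * Real.log (σ t f / σ 0 f) + t * g f) * (σ t f - v t f) = 0 := by
      refine (Finset.sum_congr rfl fun f _ => ?_).trans hsum
      rw [sub_sub]
    have := hC e
    linarith
  constructor
  · obtain ⟨S, hS, h⟩ := exists_forall_le_of (P := fun _ => True) (S := Ici (0 : ℝ))
      (F := fun e t => σ t e) (fun e _ => ⟨2 * (∑ f, C f + C e) / ℓ e, fun t ht => by
        rw [le_div_iff₀ (hℓ e)]
        have := (hlow t ht e).trans (hup t ht e)
        linarith⟩)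
    exact ⟨S, hS, fun t ht e => h e trivial t ht⟩
  · obtain ⟨K, hK, h⟩ := exists_forall_le_of (P := fun e => φ e ≠ 0) (S := Ici (0 : ℝ))
      (F := fun e t => -Real.log (σ t e / σ 0 e)) (fun e he => by
        obtain ⟨v₀, hv₀, hv₀'⟩ : ∃ v₀ > 0, ∀ t, 0 ≤ t → v₀ ≤ v t e := by
          have hφ : 0 < φ e := lt_of_le_of_ne (hsc.nonneg e) (Ne.symm he)
          refine ⟨min (φ e) (σ 0 e), lt_min hφ (hσ0 e), fun t ht => ?_⟩
          have := hE t ht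
          have := Real.exp_pos (-t)
          have := min_le_left (φ e) (σ 0 e)
          have := min_le_right (φ e) (σ 0 e)
          simp only [v]
          nlinarith
        have hsumC : 0 ≤ ∑ f, C f := Finset.sum_nonneg fun f _ => hC f
        refine ⟨((∑ f, C f) / ℓ e + σ 0 e) / v₀, fun t ht => ?_⟩
        have h1 := Real.sub_le_mul_log_div (hd.pos t ht e) (hσ0 e)
        have h2 := hup t ht e
        rw [hsc.slack_eq_zero he, mul_zero, add_zero, mul_assoc, ← le_div_iff₀' (hℓ e)] at h2
        rcases le_or_gt 0 (Real.log (σ t e / σ 0 e)) with hlog | hlog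
        · have : 0 ≤ ((∑ f, C f) / ℓ e + σ 0 e) / v₀ := by
            have := hℓ e
            have := hσ0 e
            positivity
          linarith
        · rw [le_div_iff₀ hv₀]
          have h3 := mul_le_mul_of_nonneg_left (hv₀' t ht) (neg_pos.2 hlog).le
          have := hd.pos t ht e
          nlinarith)
    exact ⟨K, hK, fun e he t ht => by linarith [h e he t ht]⟩


/-- Off the support of `φ` the conductivities decay exponentially. -/
lemma exists_decay (hd : SlopeDynamics B ℓ b σ Ψ) (hℓ : ∀ e, 0 < ℓ e)
    (hsc : StrictlyComplementary B ℓ b φ g) :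
    ∃ C, 0 ≤ C ∧ ∃ a > 0, ∀ t, 0 ≤ t → ∀ e, φ e = 0 → σ t e ≤ C * Real.exp (-a * t) := by
  classical
  have hσ0 : ∀ e, 0 < σ 0 e := hd.pos 0 le_rfl
  obtain ⟨⟨S, hS, hσS⟩, K, hK, hKlog⟩ := hd.exists_bounds hℓ hsc
  obtain ⟨K', hK', hlogK⟩ : ∃ K' > 0, ∀ t, 0 ≤ t → ∀ e, Real.log (σ t e / σ 0 e) ≤ K' := by
    obtain ⟨K', hK', h⟩ := exists_forall_le_of (P := fun _ => True) (S := Ici (0 : ℝ))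
      (F := fun e t => Real.log (σ t e / σ 0 e)) (fun e _ => ⟨S / σ 0 e, fun t ht => by
        have h1 := Real.log_le_sub_one_of_pos (div_pos (hd.pos t ht e) (hσ0 e))
        have h2 := div_le_div_of_nonneg_right (hσS t ht e) (hσ0 e).le
        linarith⟩)
    exact ⟨K', hK', fun t ht e => h e trivial t ht⟩
  obtain ⟨lam, hlam, hlamℓ⟩ := exists_pos_forall_le hℓ
  obtain ⟨θ, hθ, hθ1, hθg⟩ : ∃ θ > 0, θ ≤ 1 / 2 ∧ ∀ e, φ e = 0 → 2 * θ * ℓ e ≤ g e := by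
    obtain ⟨δ, hδ, h⟩ := exists_pos_forall_le_of (P := fun e => φ e = 0)
      (f := fun e => g e / (2 * ℓ e)) (fun e he => by
        have := (hsc.slack_pos_iff e).2 he
        have := hℓ e
        positivity)
    refine ⟨min δ (1 / 2), lt_min hδ one_half_pos, min_le_right _ _, fun e he => ?_⟩
    have h1 := (min_le_left δ (1 / 2)).trans (h e he)
    rw [le_div_iff₀ (by linarith [hℓ e])] at h1
    linarith
  obtain ⟨c, hc, hcorr⟩ := exists_linear_correction B (fun e => φ e ≠ 0)
  let m : ℝ → ℝ := fun t => ∑ e, if φ e = 0 then σ t e else 0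
  let M : ℝ := (K + K') * (∑ e, ℓ e) * (c + 1)
  let D : ℝ := ∑ e, |σ 0 e - φ e|
  let C₀ : ℝ := ∑ e, (ℓ e * σ 0 e * (1 + K') + 2 * (g e * σ 0 e))
  have hm0 : ∀ t, 0 ≤ t → 0 ≤ m t := fun t ht => Finset.sum_nonneg fun e _ => by
    split_ifs
    · exact (hd.pos t ht e).le
    · exact le_rfl
  have hsumℓ : 0 ≤ ∑ e, ℓ e := Finset.sum_nonneg fun e _ => (hℓ e).le
  have hM : 0 ≤ M := by positivity
  have hD : 0 ≤ D := Finset.sum_nonneg fun e _ => abs_nonneg _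
  have hkey : ∀ t, 0 ≤ t → (θ * lam * t - M) * m t ≤ (C₀ + M * D) * Real.exp (-θ * t) := by
    intro t ht
    have hE : Real.exp (-t) ≤ Real.exp (-θ * t) := Real.exp_le_exp.2 (by nlinarith)
    have htE : t * Real.exp (-t) ≤ 2 * Real.exp (-θ * t) := by
      have h1 : Real.exp (-t) = Real.exp (-(t / 2)) * Real.exp (-(t / 2)) := by
        rw [← Real.exp_add]; ring_nf
      have h2 := Real.mul_exp_neg_le_one (t := t / 2)
      have h3 : Real.exp (-(t / 2)) ≤ Real.exp (-θ * t) := Real.exp_le_exp.2 (by nlinarith)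
      have h4 := Real.exp_pos (-(t / 2))
      rw [h1]
      nlinarith
    set z : E → ℝ := fun e => (if φ e = 0 then σ t e else 0) - Real.exp (-t) * (σ 0 e - φ e)
      with hz
    obtain ⟨y, hy0, hyB, hyz⟩ := hcorr z (fun e => if φ e = 0 then 0 else σ t e - φ e)
      (fun e he => by simp [not_not.1 he]) (by
        rw [← hd.mulVec_eq_zero hsc.flow ht]
        congr 1
        funext e
        simp only [Pi.add_apply, hz]
        split_ifs with he
        · rw [he]; ring
        · ring)
    have hZ : ∑ e, |z e| ≤ m t + D * Real.exp (-θ * t) := by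
      have : ∀ e, |z e| ≤ (if φ e = 0 then σ t e else 0)
          + |σ 0 e - φ e| * Real.exp (-θ * t) := fun e => by
        refine (abs_sub _ _).trans (add_le_add (le_of_eq ?_) ?_)
        · rw [abs_of_nonneg]
          split_ifs
          · exact (hd.pos t ht e).le
          · exact le_rfl
        · rw [abs_mul, abs_of_pos (Real.exp_pos _), mul_comm]
          exact mul_le_mul_of_nonneg_left hE (abs_nonneg _)
      refine (Finset.sum_le_sum fun e _ => this e).trans (le_of_eq ?_)
      rw [Finset.sum_add_distrib, ← Finset.sum_mul]
    have hZ0 : 0 ≤ ∑ e, |z e| := Finset.sum_nonneg fun e _ => abs_nonneg _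
    have hterm : ∀ e, θ * lam * t * (if φ e = 0 then σ t e else 0)
        - (ℓ e * σ 0 e * (1 + K') + 2 * (g e * σ 0 e)) * Real.exp (-θ * t)
        - (K + K') * ℓ e * ((c + 1) * ∑ e, |z e|)
        ≤ (ℓ e * Real.log (σ t e / σ 0 e) + t * g e) * (y + z) e := fun e => by
      have hEpos := Real.exp_pos (-t)
      have hEθ := Real.exp_pos (-θ * t)
      have hℓe := hℓ e
      have hσ0e := hσ0 e
      have hge := hsc.slack_nonneg e
      have hσe := hd.pos t ht e
      have hlog := hlogK t ht e
      by_cases he : φ e = 0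
      · have hye : y e = 0 := hy0 e (not_not.2 he)
        have hze : (y + z) e = σ t e - Real.exp (-t) * σ 0 e := by
          simp [hye, hz, he]
        rw [hze, if_pos he]
        have h1 := Real.mul_log_div_ge (k := θ * t) hσe hσ0e
        rw [← neg_mul] at h1
        have h2 := mul_le_mul_of_nonneg_left h1 hℓe.le
        have h3 : ℓ e * (Real.exp (-t) * σ 0 e) * Real.log (σ t e / σ 0 e)
            ≤ ℓ e * σ 0 e * K' * Real.exp (-θ * t) := by
          calc ℓ e * (Real.exp (-t) * σ 0 e) * Real.log (σ t e / σ 0 e)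
              ≤ ℓ e * (Real.exp (-t) * σ 0 e) * K' :=
                mul_le_mul_of_nonneg_left hlog (by positivity)
            _ = ℓ e * σ 0 e * K' * Real.exp (-t) := by ring
            _ ≤ _ := mul_le_mul_of_nonneg_left hE (by positivity)
        have h4 : t * g e * (Real.exp (-t) * σ 0 e)
            ≤ 2 * (g e * σ 0 e) * Real.exp (-θ * t) := by
          calc t * g e * (Real.exp (-t) * σ 0 e)
              = (t * Real.exp (-t)) * (g e * σ 0 e) := by ring
            _ ≤ (2 * Real.exp (-θ * t)) * (g e * σ 0 e) :=
                mul_le_mul_of_nonneg_right htE (by positivity)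
            _ = _ := by ring
        have h5 : θ * lam * t * σ t e ≤ t * g e * σ t e - θ * t * ℓ e * σ t e := by
          have h6 : 0 ≤ t * σ t e := by positivity
          have h7 : θ * lam ≤ g e - θ * ℓ e := by
            have := hθg e he
            have := mul_le_mul_of_nonneg_left (hlamℓ e) hθ.le
            linarith
          nlinarith
        have h6 : 0 ≤ (K + K') * ℓ e * ((c + 1) * ∑ e, |z e|) := by positivity
        nlinarith
      · rw [if_neg he, hsc.slack_eq_zero he, mul_zero, mul_zero, add_zero, zero_mul, mul_zero,
          add_zero]
        have h1 : |Real.log (σ t e / σ 0 e)| ≤ K + K' :=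
          abs_le.2 ⟨by linarith [hKlog e he t ht], by linarith⟩
        have h2 : |(y + z) e| ≤ (c + 1) * ∑ e, |z e| := by
          have := hyz e
          have := Finset.single_le_sum (f := fun e => |z e|) (fun _ _ => abs_nonneg _)
            (Finset.mem_univ e)
          have := abs_add_le (y e) (z e)
          rw [Pi.add_apply]
          linarith
        have h3 := mul_le_mul h1 h2 (abs_nonneg _) (by positivity)
        rw [← abs_mul] at h3
        have h4 := mul_le_mul_of_nonneg_left ((neg_abs_le _).trans' (neg_le_neg h3)) hℓe.le
        have h5 : 0 ≤ ℓ e * σ 0 e * (1 + K') * Real.exp (-θ * t) := by positivity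
        nlinarith
    have hsum := Finset.sum_le_sum fun e (_ : e ∈ Finset.univ) => hterm e
    rw [hd.sum_log_mul_eq_zero hsc.orthogonal hyB ht, Finset.sum_sub_distrib,
      Finset.sum_sub_distrib, ← Finset.mul_sum, ← Finset.sum_mul, ← Finset.sum_mul,
      ← Finset.mul_sum] at hsum
    have h1 := mul_le_mul_of_nonneg_left hZ hM
    have h2 : (K + K') * (∑ e, ℓ e) * ((c + 1) * ∑ e, |z e|) = M * ∑ e, |z e| := by
      simp only [M]; ring
    rw [h2] at hsum
    change θ * lam * t * m t - C₀ * _ - _ ≤ 0 at hsum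
    nlinarith
  have hle : ∀ t, 0 ≤ t → ∀ e, φ e = 0 → σ t e ≤ m t := fun t ht e he => by
    have := Finset.single_le_sum (f := fun e => if φ e = 0 then σ t e else 0) (fun e _ => by
      split_ifs
      · exact (hd.pos t ht e).le
      · exact le_rfl) (Finset.mem_univ e)
    simpa only [he, if_true] using this
  have hC₀ : 0 ≤ C₀ := Finset.sum_nonneg fun e _ => by
    have := hℓ e
    have := hσ0 e
    have := hsc.slack_nonneg e
    positivity
  let T := (M + 1) / (θ * lam)
  refine ⟨C₀ + M * D + S * Real.exp (θ * T), by positivity, θ, hθ, fun t ht e he => ?_⟩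
  have hEθ := Real.exp_pos (-θ * t)
  rcases le_total T t with hT | hT
  · have h1 : 1 ≤ θ * lam * t - M := by
      have := (div_le_iff₀ (by positivity)).1 hT
      linarith
    have h2 : m t ≤ (θ * lam * t - M) * m t := le_mul_of_one_le_left (hm0 t ht) h1
    have h3 : 0 ≤ S * Real.exp (θ * T) * Real.exp (-θ * t) := by positivity
    linarith [hkey t ht, hle t ht e he]
  · have h1 : 1 ≤ Real.exp (θ * T) * Real.exp (-θ * t) := by
      rw [← Real.exp_add]
      exact Real.one_le_exp (by nlinarith)
    have h2 : 0 ≤ (C₀ + M * D) * Real.exp (-θ * t) := by positivity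
    have h3 := mul_le_mul_of_nonneg_left h1 hS.le
    linarith [hσS t ht e]

lemma two_mul_le_mul_sq_add_sq_div {s c u v : ℝ} (hc : 0 < c) (hs : c ≤ s) :
    2 * (u * v) ≤ s * u ^ 2 + v ^ 2 / c := by
  have h1 : 0 ≤ (c * u - v) ^ 2 / c := by positivity
  have h2 : (c * u - v) ^ 2 / c = c * u ^ 2 - 2 * (u * v) + v ^ 2 / c := by
    field_simp
    ring
  have h3 := mul_le_mul_of_nonneg_right hs (sq_nonneg u)
  linarith

/-- The energy bound for currents. -/
lemma mul_sq_le (hd : SlopeDynamics B ℓ b σ Ψ) (hℓ : ∀ e, 0 < ℓ e) (hφ : B *ᵥ φ = b)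
    {c t : ℝ} (hc : 0 < c) (ht : 0 ≤ t) (hcσ : ∀ e, φ e ≠ 0 → c ≤ σ t e) (e : E) :
    ℓ e * (σ t e * Ψ t e ^ 2) ≤ ∑ f, ℓ f * (φ f ^ 2 / c) := by
  have hx : B *ᵥ ((fun e => σ t e * Ψ t e) - φ) = 0 := by
    rw [mulVec_sub, hd.flow t ht, hφ, sub_self]
  have h0 := hd.orthogonal t ht _ hx
  have hterm : ∀ f, ℓ f * (σ t f * Ψ t f ^ 2) ≤
      2 * (ℓ f * Ψ t f * ((fun e => σ t e * Ψ t e) - φ) f) + ℓ f * (φ f ^ 2 / c) := fun f => by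
    rw [Pi.sub_apply]
    have hσ := hd.pos t ht f
    by_cases hf : φ f = 0
    · rw [hf]
      have : 0 ≤ ℓ f * (σ t f * Ψ t f ^ 2) := by
        have := hℓ f
        positivity
      norm_num
      nlinarith
    · have := mul_le_mul_of_nonneg_left
        (two_mul_le_mul_sq_add_sq_div (u := Ψ t f) (v := φ f) hc (hcσ f hf)) (hℓ f).le
      nlinarith
  have h1 := Finset.single_le_sum (f := fun f => ℓ f * (σ t f * Ψ t f ^ 2)) (fun f _ => by
    have := hℓ f
    have := hd.pos t ht f
    positivity) (Finset.mem_univ e)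
  have h2 := Finset.sum_le_sum fun f (_ : f ∈ Finset.univ) => hterm f
  rw [Finset.sum_add_distrib, ← Finset.mul_sum, h0] at h2
  linarith

/-- The velocities `σ' = σ (Ψ - 1)` decay exponentially. -/
lemma exists_velocity_decay (hd : SlopeDynamics B ℓ b σ Ψ) (hℓ : ∀ e, 0 < ℓ e)
    (hsc : StrictlyComplementary B ℓ b φ g) :
    ∃ C, 0 ≤ C ∧ ∃ a > 0, ∀ t, 0 ≤ t → ∀ e,
      |σ t e * Ψ t e - σ t e| ≤ C * Real.exp (-a * t) := by
  classical
  have hσ0 : ∀ e, 0 < σ 0 e := hd.pos 0 le_rfl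
  obtain ⟨⟨S, hS, hσS⟩, K, hK, hKlog⟩ := hd.exists_bounds hℓ hsc
  obtain ⟨c₀, hc₀, hcσ⟩ : ∃ c₀ > 0, ∀ t, 0 ≤ t → ∀ e, φ e ≠ 0 → c₀ ≤ σ t e := by
    obtain ⟨δ, hδ, h⟩ := exists_pos_forall_le hσ0
    refine ⟨δ * Real.exp (-K), by positivity, fun t ht e he => ?_⟩
    have h1 := Real.exp_le_exp.2 (hKlog e he t ht)
    rw [Real.exp_log (div_pos (hd.pos t ht e) (hσ0 e)), le_div_iff₀ (hσ0 e), mul_comm] at h1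
    exact (mul_le_mul_of_nonneg_right (h e) (Real.exp_pos _).le).trans h1
  obtain ⟨C₁, hC₁, a₁, ha₁, hdecay⟩ := hd.exists_decay hℓ hsc
  obtain ⟨lam, hlam, hlamℓ⟩ := exists_pos_forall_le hℓ
  obtain ⟨c, hc, hcorr⟩ := exists_linear_correction B (fun e => φ e ≠ 0)
  let Q := ∑ e, ℓ e * (φ e ^ 2 / c₀)
  have hQ : 0 ≤ Q := Finset.sum_nonneg fun e _ => by
    have := hℓ e
    positivity
  have hsumℓ : 0 ≤ ∑ e, ℓ e := Finset.sum_nonneg fun e _ => (hℓ e).le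
  let a := min (a₁ / 2) 1
  have ha : 0 < a := lt_min (by linarith) one_pos
  let R := √(Q * C₁ / lam) + C₁
  let N := ∑ e, (R + |σ 0 e - φ e|)
  have hR : 0 ≤ R := by positivity
  have hN : 0 ≤ N := by positivity
  have hoff : ∀ t, 0 ≤ t → ∀ e, φ e = 0 →
      |σ t e * Ψ t e - σ t e| ≤ R * Real.exp (-a * t) := by
    intro t ht e he
    have hσ := hd.pos t ht e
    have ha' : a ≤ a₁ / 2 := min_le_left _ _
    have h1 : Real.exp (-(a₁ / 2) * t) ≤ Real.exp (-a * t) := Real.exp_le_exp.2 (by nlinarith)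
    have h2 : Real.exp (-a₁ * t) ≤ Real.exp (-a * t) := Real.exp_le_exp.2 (by nlinarith)
    have h3 : σ t e * Ψ t e ^ 2 ≤ Q / lam := by
      rw [le_div_iff₀ hlam, mul_comm]
      refine le_trans ?_ (hd.mul_sq_le hℓ hsc.flow hc₀ ht (hcσ t ht) e)
      exact mul_le_mul_of_nonneg_right (hlamℓ e) (by positivity)
    have h4 : (σ t e * Ψ t e) ^ 2 ≤ (√(Q * C₁ / lam) * Real.exp (-(a₁ / 2) * t)) ^ 2 := by
      have h5 : Real.exp (-(a₁ / 2) * t) ^ 2 = Real.exp (-a₁ * t) := by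
        rw [sq, ← Real.exp_add]
        ring_nf
      rw [mul_pow, mul_pow, Real.sq_sqrt (by positivity), h5]
      calc σ t e ^ 2 * Ψ t e ^ 2 = σ t e * (σ t e * Ψ t e ^ 2) := by ring
        _ ≤ (C₁ * Real.exp (-a₁ * t)) * (Q / lam) :=
          mul_le_mul (hdecay t ht e he) h3 (by positivity) (by positivity)
        _ = _ := by ring
    have h5 := abs_le_of_sq_le_sq h4 (by positivity)
    have h6 := abs_sub (σ t e * Ψ t e) (σ t e)
    rw [abs_of_pos hσ] at h6
    have h7 := hdecay t ht e he
    have h8 := mul_le_mul_of_nonneg_left h1 (Real.sqrt_nonneg (Q * C₁ / lam))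
    have h9 := mul_le_mul_of_nonneg_left h2 hC₁
    have : |σ t e * Ψ t e| ≤ √(Q * C₁ / lam) * Real.exp (-(a₁ / 2) * t) := h5
    have h10 : R * Real.exp (-a * t)
        = √(Q * C₁ / lam) * Real.exp (-a * t) + C₁ * Real.exp (-a * t) := add_mul _ _ _
    linarith
  let R' := √(S * (∑ e, ℓ e) / (lam * c₀)) * (c * N)
  have hR' : 0 ≤ R' := by positivity
  refine ⟨R + R', by positivity, a, ha, fun t ht e => ?_⟩
  have hEa := Real.exp_pos (-a * t)
  by_cases he : φ e = 0
  · have := hoff t ht e he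
    nlinarith
  have hE : Real.exp (-t) ≤ Real.exp (-a * t) := by
    have : a ≤ 1 := min_le_right _ _
    exact Real.exp_le_exp.2 (by nlinarith)
  set z : E → ℝ := fun e => (if φ e = 0 then σ t e * Ψ t e - σ t e else 0)
    + Real.exp (-t) * (σ 0 e - φ e) with hz
  set w : E → ℝ := fun e => if φ e = 0 then 0 else σ t e * Ψ t e - σ t e with hw
  have hwz : B *ᵥ (w + z) = 0 := by
    have h1 : w + z = (fun e => σ t e * Ψ t e) - φ
        - (fun e => σ t e - φ e - Real.exp (-t) * (σ 0 e - φ e)) := by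
      funext e
      simp only [Pi.add_apply, Pi.sub_apply, hw, hz]
      split_ifs <;> ring
    rw [h1, mulVec_sub, mulVec_sub, hd.flow t ht, hsc.flow, hd.mulVec_eq_zero hsc.flow ht,
      sub_self, sub_zero]
  obtain ⟨y, hy0, hyB, hyz⟩ := hcorr z w (fun e he => by simp [hw, not_not.1 he]) hwz
  have hZ : ∑ e, |z e| ≤ N * Real.exp (-a * t) := by
    rw [Finset.sum_mul]
    refine Finset.sum_le_sum fun e _ => (abs_add_le _ _).trans ?_
    rw [add_mul]
    refine add_le_add ?_ ?_
    · split_ifs with he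
      · exact hoff t ht e he
      · rw [abs_zero]; positivity
    · rw [abs_mul, abs_of_pos (Real.exp_pos _), mul_comm]
      exact mul_le_mul_of_nonneg_left hE (abs_nonneg _)
  have hyN : ∀ f, y f ^ 2 ≤ (c * N * Real.exp (-a * t)) ^ 2 := fun f => by
    refine sq_le_sq' ?_ ?_ <;>
    · have := hyz f
      have := mul_le_mul_of_nonneg_left hZ hc
      have := abs_le.1 (hyz f)
      linarith
  have hx : B *ᵥ (w - y) = 0 := by
    have : w - y = (w + z) - (y + z) := by ring
    rw [this, mulVec_sub, hwz, hyB, sub_zero]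
  have hsum : ∑ f, (ℓ f * (Ψ t f - 1) + g f) * (w - y) f = 0 := by
    have h1 := hd.orthogonal t ht _ hx
    have h2 := hsc.orthogonal _ hx
    rw [← sub_zero (0 : ℝ)]
    nth_rewrite 1 [← h1]
    rw [← h2, ← Finset.sum_sub_distrib]
    exact Finset.sum_congr rfl fun f _ => by ring
  have hterm : ∀ f, (if φ f = 0 then 0 else ℓ f * (σ t f * (Ψ t f - 1) ^ 2)) ≤
      2 * ((ℓ f * (Ψ t f - 1) + g f) * (w - y) f)
        + ℓ f * ((c * N * Real.exp (-a * t)) ^ 2 / c₀) := fun f => by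
    have hℓf := hℓ f
    by_cases hf : φ f = 0
    · have : (w - y) f = 0 := by simp [hw, hf, hy0 f (not_not.2 hf)]
      rw [if_pos hf, this]
      have : 0 ≤ ℓ f * ((c * N * Real.exp (-a * t)) ^ 2 / c₀) := by positivity
      linarith
    · have h1 : (w - y) f = σ t f * (Ψ t f - 1) - y f := by
        simp only [Pi.sub_apply, hw, if_neg hf]
        ring
      rw [if_neg hf, h1, hsc.slack_eq_zero hf, add_zero]
      have h2 := mul_le_mul_of_nonneg_left
        (two_mul_le_mul_sq_add_sq_div (u := Ψ t f - 1) (v := y f) hc₀ (hcσ t ht f hf)) hℓf.le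
      have h3 := mul_le_mul_of_nonneg_left (div_le_div_of_nonneg_right (hyN f) hc₀.le) hℓf.le
      nlinarith
  have henergy : ℓ e * (σ t e * (Ψ t e - 1) ^ 2) ≤
      (∑ f, ℓ f) * ((c * N * Real.exp (-a * t)) ^ 2 / c₀) := by
    have h1 := Finset.single_le_sum
      (f := fun f => if φ f = 0 then 0 else ℓ f * (σ t f * (Ψ t f - 1) ^ 2)) (fun f _ => by
        have := hℓ f
        have := hd.pos t ht f
        split_ifs <;> positivity) (Finset.mem_univ e)
    have h2 := Finset.sum_le_sum fun f (_ : f ∈ Finset.univ) => hterm f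
    rw [Finset.sum_add_distrib, ← Finset.mul_sum, hsum, ← Finset.sum_mul] at h2
    simp only [if_neg he] at h1
    linarith
  have hσ := hd.pos t ht e
  have hsq : (σ t e * Ψ t e - σ t e) ^ 2 ≤ (R' * Real.exp (-a * t)) ^ 2 := by
    have h1 : σ t e * (Ψ t e - 1) ^ 2 ≤
        (∑ f, ℓ f) * ((c * N * Real.exp (-a * t)) ^ 2 / c₀) / lam := by
      rw [le_div_iff₀ hlam, mul_comm]
      exact (mul_le_mul_of_nonneg_right (hlamℓ e) (by positivity)).trans henergy
    simp only [R']
    rw [mul_assoc, mul_pow (√_), Real.sq_sqrt (by positivity)]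
    calc (σ t e * Ψ t e - σ t e) ^ 2 = σ t e * (σ t e * (Ψ t e - 1) ^ 2) := by ring
      _ ≤ S * ((∑ f, ℓ f) * ((c * N * Real.exp (-a * t)) ^ 2 / c₀) / lam) :=
        mul_le_mul (hσS t ht e) h1 (by positivity) hS.le
      _ = _ := by field_simp
  have h1 : |σ t e * Ψ t e - σ t e| ≤ R' * Real.exp (-a * t) :=
    abs_le_of_sq_le_sq hsq (by positivity)
  nlinarith

end SlopeDynamics

lemma exists_limit_of_deriv_exp_decay {f f' : ℝ → ℝ} {C a : ℝ} (ha : 0 < a)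
    (hf : ∀ t, 0 ≤ t → HasDerivWithinAt f (f' t) (Ici 0) t)
    (hf' : ∀ t, 0 ≤ t → |f' t| ≤ C * Real.exp (-a * t)) :
    ∃ F, ∀ t, 0 ≤ t → |f t - F| ≤ C / a * Real.exp (-a * t) := by
  have hC : 0 ≤ C := by simpa using (abs_nonneg _).trans (hf' 0 le_rfl)
  have hdiff : ∀ s t, 0 ≤ s → s ≤ t → |f t - f s| ≤ C / a * Real.exp (-a * s) := by
    intro s t hs hst
    have h := image_norm_le_of_norm_deriv_right_le_deriv_boundary (a := s) (b := t)
      (f := fun x => f x - f s) (f' := f')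
      (B := fun x => C / a * (Real.exp (-a * s) - Real.exp (-a * x)))
      (B' := fun x => C * Real.exp (-a * x))
      (fun x hx => (((hf x (hs.trans hx.1)).sub_const _).mono
        (Icc_subset_Ici_self.trans (Ici_subset_Ici.2 hs))).continuousWithinAt)
      (fun x hx => ((hf x (hs.trans hx.1)).sub_const _).mono
        (Ici_subset_Ici.2 (hs.trans hx.1)))
      (by simp)
      (fun x => by
        have h1 : HasDerivAt (fun x => Real.exp (-a * x)) (Real.exp (-a * x) * (-a * 1)) x :=
          ((hasDerivAt_id x).const_mul (-a)).exp
        refine ((h1.const_sub _).const_mul _).congr_deriv ?_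
        field_simp)
      (fun x hx => hf' x (hs.trans hx.1)) ⟨hst, le_rfl⟩
    rw [Real.norm_eq_abs] at h
    refine h.trans (mul_le_mul_of_nonneg_left ?_ (by positivity))
    linarith [Real.exp_pos (-a * t)]
  have htend : Tendsto (fun n : ℕ => C / a * Real.exp (-a * n)) atTop (𝓝 0) := by
    rw [← mul_zero (C / a)]
    refine (Real.tendsto_exp_atBot.comp ?_).const_mul _
    exact (tendsto_natCast_atTop_atTop).const_mul_atTop_of_neg (neg_neg_of_pos ha)
  have hcauchy : CauchySeq fun n : ℕ => f n := by
    refine cauchySeq_of_le_tendsto_0' _ (fun n m hnm => ?_) htend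
    rw [dist_comm, Real.dist_eq]
    exact hdiff n m (Nat.cast_nonneg n) (Nat.cast_le.2 hnm)
  obtain ⟨F, hF⟩ := cauchySeq_tendsto_of_complete hcauchy
  refine ⟨F, fun t ht => ?_⟩
  rw [abs_sub_comm]
  refine le_of_tendsto ((hF.sub_const (f t)).abs) ?_
  filter_upwards [eventually_ge_atTop ⌈t⌉₊] with n hn
  exact hdiff t n ht (Nat.ceil_le.1 hn)

/-- The currents converge exponentially to a positive flow with the support of `φ`. -/
lemma SlopeDynamics.exists_limit {B : Matrix V E ℝ} {ℓ : E → ℝ} {b : V → ℝ}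
    {σ Ψ : ℝ → E → ℝ} {φ g : E → ℝ} (hd : SlopeDynamics B ℓ b σ Ψ) (hℓ : ∀ e, 0 < ℓ e)
    (hsc : StrictlyComplementary B ℓ b φ g) :
    ∃ F : E → ℝ, B *ᵥ F = b ∧ (∀ e, 0 ≤ F e) ∧ (∀ e, F e = 0 ↔ φ e = 0) ∧
      ∃ C > 0, ∃ a > 0, ∀ t, 0 ≤ t → ∀ e, |σ t e * Ψ t e - F e| ≤ C * Real.exp (-a * t) := by
  have hσ0 : ∀ e, 0 < σ 0 e := hd.pos 0 le_rfl
  obtain ⟨C, hC, a, ha, hvel⟩ := hd.exists_velocity_decay hℓ hsc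
  choose F hF using fun e => exists_limit_of_deriv_exp_decay ha
    (fun t ht => hd.hasDeriv t ht e) (fun t ht => hvel t ht e)
  have hexp : ∀ K, Tendsto (fun t => K * Real.exp (-a * t)) atTop (𝓝 0) := fun K => by
    rw [← mul_zero K]
    exact (Real.tendsto_exp_atBot.comp
      (tendsto_id.const_mul_atTop_of_neg (neg_neg_of_pos ha))).const_mul K
  have hσF : ∀ e, Tendsto (fun t => σ t e) atTop (𝓝 (F e)) := fun e => by
    rw [tendsto_iff_dist_tendsto_zero]
    refine squeeze_zero' (Eventually.of_forall fun _ => dist_nonneg) ?_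
      (hexp (C / a))
    filter_upwards [eventually_ge_atTop 0] with t ht using hF e t ht
  have hcur : ∀ t, 0 ≤ t → ∀ e,
      |σ t e * Ψ t e - F e| ≤ (C + C / a + 1) * Real.exp (-a * t) := fun t ht e => by
    have h1 := abs_add_le (σ t e * Ψ t e - σ t e) (σ t e - F e)
    rw [sub_add_sub_cancel] at h1
    have := hvel t ht e
    have := hF e t ht
    have := Real.exp_pos (-a * t)
    linarith
  have hcurF : ∀ e, Tendsto (fun t => σ t e * Ψ t e) atTop (𝓝 (F e)) := fun e => by
    rw [tendsto_iff_dist_tendsto_zero]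
    refine squeeze_zero' (Eventually.of_forall fun _ => dist_nonneg) ?_
      (hexp (C + C / a + 1))
    filter_upwards [eventually_ge_atTop 0] with t ht using hcur t ht e
  have hF0 : ∀ e, 0 ≤ F e := fun e => ge_of_tendsto (hσF e) (by
    filter_upwards [eventually_ge_atTop 0] with t ht using (hd.pos t ht e).le)
  refine ⟨F, ?_, hF0, fun e => ⟨fun he => ?_, fun he => ?_⟩, C + C / a + 1, by positivity, a, ha,
    hcur⟩
  · funext i
    have h1 : Tendsto (fun t => ∑ e, B i e * (σ t e * Ψ t e)) atTop (𝓝 (∑ e, B i e * F e)) :=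
      tendsto_finsetSum _ fun e _ => (hcurF e).const_mul _
    refine tendsto_nhds_unique h1 (tendsto_const_nhds.congr' ?_)
    filter_upwards [eventually_ge_atTop 0] with t ht
    exact (congrFun (hd.flow t ht) i).symm
  · by_contra hne
    obtain ⟨-, K, hK, hKlog⟩ := hd.exists_bounds hℓ hsc
    have h1 : Real.exp (-K) * σ 0 e ≤ F e := ge_of_tendsto (hσF e) (by
      filter_upwards [eventually_ge_atTop 0] with t ht
      have h2 := Real.exp_le_exp.2 (hKlog e hne t ht)
      rwa [Real.exp_log (div_pos (hd.pos t ht e) (hσ0 e)), le_div_iff₀ (hσ0 e)] at h2)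
    have := mul_pos (Real.exp_pos (-K)) (hσ0 e)
    linarith
  · obtain ⟨C₁, -, a₁, ha₁, hdecay⟩ := hd.exists_decay hℓ hsc
    have hexp₁ : Tendsto (fun t => C₁ * Real.exp (-a₁ * t)) atTop (𝓝 0) := by
      simpa using (Real.tendsto_exp_atBot.comp
        (tendsto_id.const_mul_atTop_of_neg (neg_neg_of_pos ha₁))).const_mul C₁
    refine le_antisymm (le_of_tendsto_of_tendsto (hσF e) hexp₁ ?_) (hF0 e)
    filter_upwards [eventually_ge_atTop 0] with t ht using hdecay t ht e he

end Dynamics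

section Potentials

variable {V E : Type*} [Fintype V] [DecidableEq V] {tail head : E → V}

lemma incMatrix_transpose_mulVec (hloops : NoLoops tail head) (q : V → ℝ) (e : E) :
    ((incMatrix tail head)ᵀ *ᵥ q) e = q (tail e) - q (head e) := by
  have : ∀ i, (incMatrix tail head)ᵀ e i * q i
      = (if tail e = i then q i else 0) - (if head e = i then q i else 0) := fun i => by
    simp only [incMatrix, transpose_apply, of_apply]
    by_cases h1 : tail e = i
    · have h2 : head e ≠ i := fun h2 => hloops e (h1.trans h2.symm)
      simp [h1, h2]
    · by_cases h2 : head e = i <;> simp [h1, h2]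
  simp only [mulVec, dotProduct, this, Finset.sum_sub_distrib]
  simp

variable [Fintype E] [DecidableEq E] {ℓ : E → ℝ} {b : V → ℝ} {σ : ℝ → E → ℝ} {p : ℝ → V → ℝ}

lemma PhysarumDynamics.slopeDynamics (hloops : NoLoops tail head) (hℓ : ∀ e, 0 < ℓ e)
    (hdyn : PhysarumDynamics tail head ℓ b σ p) :
    SlopeDynamics (incMatrix tail head) ℓ b σ (fun t => field tail head ℓ (p t)) where
  pos := hdyn.pos
  flow t ht := by
    rw [← hdyn.kirchhoff t ht, lap, ← mulVec_mulVec, ← mulVec_mulVec]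
    congr 1
    funext e
    rw [mulVec_diagonal, incMatrix_transpose_mulVec hloops, field]
    ring
  orthogonal t _ x hx := by
    have h : ∑ e, ((incMatrix tail head)ᵀ *ᵥ p t) e * x e = 0 := by
      change ((incMatrix tail head)ᵀ *ᵥ p t) ⬝ᵥ x = 0
      rw [mulVec_transpose, ← dotProduct_mulVec, hx, dotProduct_zero]
    refine (Finset.sum_congr rfl fun e _ => ?_).trans h
    rw [incMatrix_transpose_mulVec hloops, field, mul_div_cancel₀ _ (hℓ e).ne']
  hasDeriv t ht e := hdyn.dyn t ht e

end Potentials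

theorem statement_14 {V E : Type*} [Fintype V] [Fintype E] [DecidableEq V] [DecidableEq E]
    (tail head : E → V)
    (hloops : NoLoops tail head) (hmult : NoMultiple tail head)
    (hconn : IsConnectedGraph tail head)
    (ℓ : E → ℝ) (hℓ : ∀ e, 0 < ℓ e)
    (b : V → ℝ) (hb : ∑ i, b i = 0)
    (hfeas : Feasible tail head b)
    (σ : ℝ → E → ℝ) (p : ℝ → V → ℝ)
    (hdyn : PhysarumDynamics tail head ℓ b σ p) :
    ∃ φhat : E → ℝ, IsOptimal tail head ℓ b φhat ∧
      suppE φhat = optSupport tail head ℓ b ∧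
      ∃ C > (0:ℝ), ∃ a > (0:ℝ), ∀ t : ℝ, 0 ≤ t →
        ∀ e : E, |current tail head ℓ σ p t e - φhat e| ≤ C * Real.exp (-a * t) := by
  obtain ⟨φ, hφ, hsupp⟩ := exists_isOptimal_full_support hℓ hfeas
  obtain ⟨g, hsc⟩ := hφ.exists_strictlyComplementary hsupp
  obtain ⟨F, hF, hF0, hFφ, hconv⟩ := (hdyn.slopeDynamics hloops hℓ).exists_limit hℓ hsc
  have hopt : IsOptimal tail head ℓ b F := hsc.isOptimal hF hF0 fun e he => (hFφ e).2 he
  refine ⟨F, hopt, ?_, hconv⟩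
  ext e
  refine ⟨fun he => ⟨F, hopt, lt_of_le_of_ne (hF0 e) (Ne.symm he)⟩, fun he => ?_⟩
  exact fun h => (hsupp e he).ne' ((hFφ e).1 h)
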